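/- Let Z be a locally profinite abelian group and k a field. Let E be the k-algebra of k-linear endomorphisms of C_c^∞(Z,k) that commute with the translation action of Z, i.e. with all maps f ↦ (x ↦ f(z⁻¹x)) for z ∈ Z. Let k̂[Z] be the k-algebra of compatible families (x_{Z'})_{Z'} ∈ Π_{Z'} k[Z/Z'], the product ranging over all compact open subgroups Z' of Z, where compatibility means: whenever Z'' ⊆ Z' are compact open subgroups, the image of x_{Z''} under the k-algebra map k[Z/Z''] → k[Z/Z'] induced by the quotient homomorphism Z/Z'' → Z/Z' equals x_{Z'}; the operations on k̂[Z] are componentwise. Then E and k̂[Z] are isomorphic as k-algebras. -/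

import Mathlib

/-- The space `C_c^∞(Z,k)` of locally constant compactly supported `k`-valued functions,
as a `k`-submodule of `Z → k`. -/
def SmoothCc (k Z : Type*) [Field k] [TopologicalSpace Z] : Submodule k (Z → k) where
  carrier := {f | IsLocallyConstant f ∧ HasCompactSupport f}
  add_mem' := fun hf hg => ⟨hf.1.add hg.1, hf.2.add hg.2⟩
  zero_mem' := ⟨IsLocallyConstant.const 0, by
    rw [HasCompactSupport, tsupport]
    simp⟩
  smul_mem' := fun c f hf => ⟨hf.1.comp (c * ·), by
    have h := HasCompactSupport.smul_left (f := fun _ : Z => c) hf.2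
    exact h⟩

/-- A `k`-linear endomorphism `T` of `C_c^∞(Z,k)` commutes with the translation action
`(z · f)(x) = f(z⁻¹x)` of `Z`. -/
def CommutesTrans {k Z : Type*} [Field k] [CommGroup Z] [TopologicalSpace Z]
    (T : Module.End k (SmoothCc k Z)) : Prop :=
  ∀ (z : Z) (f h : SmoothCc k Z), (∀ x : Z, (h : Z → k) x = (f : Z → k) (z⁻¹ * x)) →
    ∀ x : Z, (T h : Z → k) x = (T f : Z → k) (z⁻¹ * x)

/-- The completion `k̂[Z] = lim_{Z'} k[Z/Z']` of the group algebra of a locally profinite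
abelian group `Z`, realised as the `k`-subalgebra of compatible families inside the
product of the group algebras `k[Z/Z']` over all compact open subgroups `Z'` of `Z`,
the compatibility being via the maps `k[Z/Z''] → k[Z/Z']` induced by the quotient
homomorphisms `Z/Z'' → Z/Z'` for `Z'' ⊆ Z'`. -/
noncomputable def hatGroupAlgebra (k Z : Type*) [Field k] [CommGroup Z]
    [TopologicalSpace Z] :
    Subalgebra k (Π H : {H : Subgroup Z // IsCompact (H : Set Z) ∧ IsOpen (H : Set Z)},
      MonoidAlgebra k (Z ⧸ H.1)) where
  carrier := {x | ∀ (i j : {H : Subgroup Z // IsCompact (H : Set Z) ∧ IsOpen (H : Set Z)})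
    (hij : i.1 ≤ j.1),
    MonoidAlgebra.mapDomainAlgHom k k
      (QuotientGroup.map i.1 j.1 (MonoidHom.id Z) (by simpa using hij)) (x i) = x j}
  mul_mem' := fun hx hy i j hij => by
    simp only [Pi.mul_apply, map_mul, hx i j hij, hy i j hij]
  add_mem' := fun hx hy i j hij => by
    simp only [Pi.add_apply, map_add, hx i j hij, hy i j hij]
  algebraMap_mem' := fun r i j hij => by
    simp only [Pi.algebraMap_apply, AlgHom.commutes]

namespace HatAux

open Topology Filter

variable {k Z : Type*} [Field k] [CommGroup Z] [TopologicalSpace Z]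

/-- compact open subgroups -/
abbrev CO (Z : Type*) [CommGroup Z] [TopologicalSpace Z] :=
  {H : Subgroup Z // IsCompact (H : Set Z) ∧ IsOpen (H : Set Z)}

/-- restriction of families -/
noncomputable abbrev proj (k : Type*) [Field k] (H : CO Z) :
    MonoidAlgebra k Z →ₐ[k] MonoidAlgebra k (Z ⧸ H.1) :=
  MonoidAlgebra.mapDomainAlgHom k k (QuotientGroup.mk' H.1)

lemma proj_surj (H : CO Z) : Function.Surjective (proj k H) := by
  intro x
  refine ⟨MonoidAlgebra.mapDomain Quotient.out x, ?_⟩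
  ext q
  have : ((QuotientGroup.mk' H.1 : Z → Z ⧸ H.1) ∘ (Quotient.out : Z ⧸ H.1 → Z)) = id := by
    funext q; exact Quotient.out_eq q
  change Finsupp.mapDomain (QuotientGroup.mk' H.1) (Finsupp.mapDomain Quotient.out x.coeff) q = _
  rw [← Finsupp.mapDomain_comp, this, Finsupp.mapDomain_id]

lemma map_proj (i j : CO Z) (hij : i.1 ≤ j.1) (a : MonoidAlgebra k Z) :
    MonoidAlgebra.mapDomainAlgHom k k
      (QuotientGroup.map i.1 j.1 (MonoidHom.id Z) (by simpa using hij)) (proj k i a)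
      = proj k j a := by
  rw [← AlgHom.comp_apply, ← MonoidAlgebra.mapDomainAlgHom_comp]
  rfl

variable [IsTopologicalGroup Z]

/-- translation -/
def tr (k Z : Type*) [Field k] [CommGroup Z] [TopologicalSpace Z] [IsTopologicalGroup Z] :
    Z →* Module.End k (SmoothCc k Z) where
  toFun z :=
    { toFun := fun f => ⟨fun x => f.1 (z⁻¹ * x),
        f.2.1.comp_continuous (continuous_const_mul z⁻¹),
        f.2.2.comp_homeomorph (Homeomorph.mulLeft z⁻¹)⟩
      map_add' := fun _ _ => rfl
      map_smul' := fun _ _ => rfl }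
  map_one' := by ext f x; simp
  map_mul' z w := by ext f x; simp [mul_assoc, mul_comm]

@[simp] lemma tr_apply (z : Z) (f : SmoothCc k Z) (x : Z) :
    (tr k Z z f).1 x = f.1 (z⁻¹ * x) := rfl

/-- the action of the group algebra -/
noncomputable def rho (k Z : Type*) [Field k] [CommGroup Z] [TopologicalSpace Z]
    [IsTopologicalGroup Z] : MonoidAlgebra k Z →ₐ[k] Module.End k (SmoothCc k Z) :=
  MonoidAlgebra.lift k _ Z (tr k Z)

lemma rho_single (z : Z) (c : k) (f : SmoothCc k Z) :
    rho k Z (MonoidAlgebra.single z c) f = c • tr k Z z f := by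
  simp [rho, MonoidAlgebra.lift_single]

lemma rho_comm (a b : MonoidAlgebra k Z) (f : SmoothCc k Z) :
    rho k Z a (rho k Z b f) = rho k Z b (rho k Z a f) := by
  rw [← Module.End.mul_apply, ← Module.End.mul_apply, ← map_mul, ← map_mul, mul_comm]

lemma trans_eq_rho (z : Z) (f : SmoothCc k Z) :
    tr k Z z f = rho k Z (MonoidAlgebra.single z 1) f := by
  rw [rho_single, one_smul]

/-- invariance -/
def Inv (H : CO Z) (f : SmoothCc k Z) : Prop := ∀ h ∈ H.1, tr k Z h f = f

lemma Inv.mono {H K : CO Z} {f : SmoothCc k Z} (h : Inv H f) (hK : K.1 ≤ H.1) : Inv K f :=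
  fun x hx => h x (hK hx)

lemma Inv.rho {H : CO Z} {f : SmoothCc k Z} (h : Inv H f) (a : MonoidAlgebra k Z) :
    Inv H (rho k Z a f) := by
  intro x hx
  rw [trans_eq_rho, rho_comm, ← trans_eq_rho, h x hx]

lemma Inv.add {H : CO Z} {f g : SmoothCc k Z} (h : Inv H f) (h' : Inv H g) :
    Inv H (f + g) := by
  intro x hx
  rw [map_add, h x hx, h' x hx]

lemma Inv.smul {H : CO Z} {f : SmoothCc k Z} (h : Inv H f) (c : k) :
    Inv H (c • f) := by
  intro x hx
  rw [map_smul, h x hx]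

/-- orbit map on the quotient -/
noncomputable def orb (H : CO Z) (f : SmoothCc k Z) :
    MonoidAlgebra k (Z ⧸ H.1) → SmoothCc k Z := fun a =>
  Finsupp.linearCombination k (fun q : Z ⧸ H.1 => tr k Z q.out f) a.coeff

lemma orb_proj {H : CO Z} {f : SmoothCc k Z} (h : Inv H f) (a : MonoidAlgebra k Z) :
    orb H f (proj k H a) = rho k Z a f := by
  induction a using MonoidAlgebra.induction_linear with
  | zero => simp [orb]
  | add a b ha hb =>
    simp only [orb, map_add, MonoidAlgebra.coeff_add, LinearMap.add_apply] at *
    rw [ha, hb]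
  | single z c =>
    rw [rho_single]
    have h1 : proj k H (MonoidAlgebra.single z c) =
      MonoidAlgebra.single (QuotientGroup.mk z) c := by simp [proj]
    rw [h1, orb, MonoidAlgebra.coeff_single, Finsupp.linearCombination_single]
    obtain ⟨y, hy⟩ := QuotientGroup.mk_out_eq_mul H.1 z
    rw [hy, map_mul, Module.End.mul_apply, h y y.2]

lemma rho_congr {H : CO Z} {f : SmoothCc k Z} (h : Inv H f) {a b : MonoidAlgebra k Z}
    (hab : proj k H a = proj k H b) : rho k Z a f = rho k Z b f := by
  rw [← orb_proj h, ← orb_proj h, hab]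

/-- indicator of a compact open set -/
noncomputable def ind (k : Type*) [Field k] (U : Set Z) (hU : IsCompact U) (hU' : IsClopen U) :
    SmoothCc k Z :=
  ⟨U.indicator (fun _ => 1), (LocallyConstant.charFn k hU').isLocallyConstant,
    HasCompactSupport.of_support_subset_isCompact hU Set.support_indicator_subset⟩

/-- indicator of a compact open subgroup -/
noncomputable def indH (k : Type*) [Field k] (H : CO Z) : SmoothCc k Z :=
  ind k (H.1 : Set Z) H.2.1 ⟨H.1.isClosed_of_isOpen H.2.2, H.2.2⟩

lemma inv_indH (H : CO Z) : Inv H (indH k H) := by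
  classical
  intro h hh
  ext x
  simp only [indH, ind, tr_apply, Set.indicator_apply, SetLike.mem_coe]
  rw [H.1.mul_mem_cancel_left (H.1.inv_mem hh)]

lemma rho_indH (H : CO Z) (a : MonoidAlgebra k Z) (y : Z) :
    (rho k Z a (indH k H)).1 y = (proj k H a).coeff (QuotientGroup.mk y) := by
  classical
  induction a using MonoidAlgebra.induction_linear with
  | zero => simp
  | add a b ha hb =>
    simp only [map_add, MonoidAlgebra.coeff_add, LinearMap.add_apply, Finsupp.add_apply] at *
    rw [← ha, ← hb]; rfl
  | single z c =>
    rw [rho_single]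
    have h1 : proj k H (MonoidAlgebra.single z c) =
      MonoidAlgebra.single (QuotientGroup.mk z) c := by simp [proj]
    rw [h1, MonoidAlgebra.coeff_single, Finsupp.single_apply]
    change c * (tr k Z z (indH k H)).1 y = _
    simp only [indH, ind, tr_apply, Set.indicator_apply, SetLike.mem_coe, QuotientGroup.eq]
    simp

lemma exists_rho (H : CO Z) {f : SmoothCc k Z} (h : Inv H f) :
    ∃ b : MonoidAlgebra k Z, f = rho k Z b (indH k H) := by
  classical
  have hinv : ∀ x y : Z, (QuotientGroup.leftRel H.1).r x y → f.1 x = f.1 y := by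
    intro x y hxy
    have hxy' : x⁻¹ * y ∈ H.1 := QuotientGroup.leftRel_apply.mp hxy
    have := congrArg (fun g : SmoothCc k Z => g.1 y) (h _ hxy')
    simp only [tr_apply] at this
    rw [← this]; congr 1; simp [mul_comm]
  let F : Z ⧸ H.1 → k := Quotient.lift f.1 hinv
  have hfin : (Function.support F).Finite := by
    have hc : IsCompact (tsupport f.1) := f.2.2
    obtain ⟨t, ht⟩ := hc.elim_finite_subcover (fun q : Z ⧸ H.1 => {x : Z | (x : Z ⧸ H.1) = q})
      (fun q => by
        obtain ⟨z, rfl⟩ := QuotientGroup.mk_surjective q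
        have : {x : Z | (x : Z ⧸ H.1) = z} = (fun x => x⁻¹ * z) ⁻¹' (H.1 : Set Z) := by
          ext x; simp [QuotientGroup.eq]
        rw [this]
        exact H.2.2.preimage (by fun_prop))
      (fun x _ => Set.mem_iUnion.2 ⟨_, rfl⟩)
    refine t.finite_toSet.subset ?_
    intro q hq
    obtain ⟨z, rfl⟩ := QuotientGroup.mk_surjective q
    have hz : f.1 z ≠ 0 := hq
    have := ht (subset_tsupport _ hz)
    simp only [Set.mem_iUnion, Set.mem_ofPred_eq] at this
    obtain ⟨q, hq, rfl⟩ := this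
    exact hq
  obtain ⟨b, hb⟩ := proj_surj (k := k) H (.ofCoeff (Finsupp.ofSupportFinite F hfin))
  refine ⟨b, ?_⟩
  ext y
  rw [rho_indH, hb]
  rfl

/-- stabiliser of a function -/
def stab (f : SmoothCc k Z) : Subgroup Z where
  carrier := {z | tr k Z z f = f}
  one_mem' := by simp
  mul_mem' {a b} ha hb := by
    simp only [Set.mem_ofPred_eq] at *
    rw [map_mul, Module.End.mul_apply, hb, ha]
  inv_mem' {a} ha := by
    simp only [Set.mem_ofPred_eq] at *
    conv_lhs => rw [← ha]
    rw [← Module.End.mul_apply, ← map_mul]; simp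

lemma isOpen_stab (f : SmoothCc k Z) : IsOpen (stab f : Set Z) := by
  apply Subgroup.isOpen_of_mem_nhds (g := 1)
  have hc : IsCompact (tsupport f.1) := f.2.2
  have key : ∀ᶠ h in 𝓝 (1 : Z), ∀ x ∈ tsupport f.1, f.1 (h * x) = f.1 x := by
    apply hc.eventually_forall_of_forall_eventually
    intro x _
    have h1 : IsLocallyConstant (fun p : Z × Z => f.1 (p.1 * p.2)) :=
      f.2.1.comp_continuous continuous_mul
    have h2 : IsLocallyConstant (fun p : Z × Z => f.1 p.2) :=
      f.2.1.comp_continuous continuous_snd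
    filter_upwards [h1.eventually_eq (1, x), h2.eventually_eq (1, x)] with p hp hp'
    rw [hp, hp']; simp
  have key' : ∀ᶠ h in 𝓝 (1 : Z), ∀ x ∈ tsupport f.1, f.1 (h⁻¹ * x) = f.1 x := by
    have : Tendsto (fun h : Z => h⁻¹) (𝓝 1) (𝓝 1) := by
      simpa using (continuous_inv (G := Z)).tendsto 1
    exact this.eventually key
  filter_upwards [key, key'] with h h1 h2
  change tr k Z h f = f
  ext x
  rw [tr_apply]
  by_cases hx : x ∈ tsupport f.1
  · exact h2 x hx
  · have hx0 : f.1 x = 0 := image_eq_zero_of_notMem_tsupport hx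
    by_contra hne
    rw [hx0] at hne
    have := h1 _ (subset_tsupport _ hne)
    rw [mul_inv_cancel_left, hx0] at this
    exact hne this.symm

variable [LocallyCompactSpace Z] [T2Space Z] [TotallyDisconnectedSpace Z]

lemma exists_inv (f : SmoothCc k Z) : ∃ H : CO Z, Inv H f := by
  classical
  obtain ⟨K, hK, hK1⟩ := exists_compact_mem_nhds (1 : Z)
  obtain ⟨U, hU, h1U, hUK⟩ :=
    (loc_compact_Haus_tot_disc_of_zero_dim (H := Z)).mem_nhds_iff.1 hK1
  have hUc : IsCompact U := hK.of_isClosed_subset hU.1 hUK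
  let g := ind k U hUc hU
  have hsub : ((stab f ⊓ stab g : Subgroup Z) : Set Z) ⊆ U := by
    intro z hz
    have hz2 : tr k Z z g = g := hz.2
    have := congrArg (fun g : SmoothCc k Z => g.1 z) hz2
    simp only [tr_apply, g, ind, inv_mul_cancel, Set.indicator_apply, if_pos h1U] at this
    by_contra h
    rw [if_neg h] at this
    exact one_ne_zero this
  have ho : IsOpen ((stab f ⊓ stab g : Subgroup Z) : Set Z) :=
    (isOpen_stab f).inter (isOpen_stab g)
  exact ⟨⟨stab f ⊓ stab g, hUc.of_isClosed_subset (Subgroup.isClosed_of_isOpen _ ho) hsub, ho⟩,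
    fun z hz => hz.1⟩

lemma exists_le (H K : CO Z) : ∃ L : CO Z, L.1 ≤ H.1 ∧ L.1 ≤ K.1 :=
  ⟨⟨H.1 ⊓ K.1, H.2.1.inter K.2.1, H.2.2.inter K.2.2⟩, inf_le_left, inf_le_right⟩

/-- the action, as a function -/
noncomputable def phi (x : hatGroupAlgebra k Z) (f : SmoothCc k Z) : SmoothCc k Z :=
  orb (exists_inv f).choose f (x.1 (exists_inv f).choose)

lemma phi_eq (x : hatGroupAlgebra k Z) {f : SmoothCc k Z} {H : CO Z} (h : Inv H f)
    {a : MonoidAlgebra k Z} (ha : proj k H a = x.1 H) : phi x f = rho k Z a f := by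
  obtain ⟨L, h1, h2⟩ := exists_le H (exists_inv f).choose
  obtain ⟨b, hb⟩ := proj_surj (k := k) L (x.1 L)
  have e1 : proj k H b = x.1 H := by rw [← map_proj L H h1, hb, x.2 L H h1]
  have e2 : proj k (exists_inv f).choose b = x.1 (exists_inv f).choose := by
    rw [← map_proj L _ h2, hb, x.2 L _ h2]
  rw [phi, ← e2, orb_proj (exists_inv f).choose_spec]
  exact rho_congr h (e1.trans ha.symm)

lemma phi_add_right (x : hatGroupAlgebra k Z) (f g : SmoothCc k Z) :
    phi x (f + g) = phi x f + phi x g := by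
  obtain ⟨H, hH⟩ := exists_inv f
  obtain ⟨K, hK⟩ := exists_inv g
  obtain ⟨L, h1, h2⟩ := exists_le H K
  obtain ⟨a, ha⟩ := proj_surj (k := k) L (x.1 L)
  rw [phi_eq x (hH.mono h1) ha, phi_eq x (hK.mono h2) ha,
    phi_eq x ((hH.mono h1).add (hK.mono h2)) ha, map_add]

lemma phi_smul_right (x : hatGroupAlgebra k Z) (c : k) (f : SmoothCc k Z) :
    phi x (c • f) = c • phi x f := by
  obtain ⟨H, hH⟩ := exists_inv f
  obtain ⟨a, ha⟩ := proj_surj (k := k) H (x.1 H)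
  rw [phi_eq x hH ha, phi_eq x (hH.smul c) ha, map_smul]

lemma phi_add_left (x y : hatGroupAlgebra k Z) (f : SmoothCc k Z) :
    phi (x + y) f = phi x f + phi y f := by
  obtain ⟨H, hH⟩ := exists_inv f
  obtain ⟨a, ha⟩ := proj_surj (k := k) H (x.1 H)
  obtain ⟨b, hb⟩ := proj_surj (k := k) H (y.1 H)
  have h : proj k H (a + b) = (x + y).1 H := by
    rw [map_add, ha, hb]; rfl
  rw [phi_eq x hH ha, phi_eq y hH hb, phi_eq (x + y) hH h, map_add, LinearMap.add_apply]

lemma phi_smul_left (c : k) (x : hatGroupAlgebra k Z) (f : SmoothCc k Z) :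
    phi (c • x) f = c • phi x f := by
  obtain ⟨H, hH⟩ := exists_inv f
  obtain ⟨a, ha⟩ := proj_surj (k := k) H (x.1 H)
  have h : proj k H (c • a) = (c • x).1 H := by
    rw [map_smul, ha]; rfl
  rw [phi_eq x hH ha, phi_eq (c • x) hH h, map_smul, LinearMap.smul_apply]

lemma phi_one (f : SmoothCc k Z) : phi (1 : hatGroupAlgebra k Z) f = f := by
  obtain ⟨H, hH⟩ := exists_inv f
  have h : proj k H 1 = (1 : hatGroupAlgebra k Z).1 H := by
    rw [map_one]; rfl
  rw [phi_eq 1 hH h, map_one, Module.End.one_apply]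

lemma phi_mul (x y : hatGroupAlgebra k Z) (f : SmoothCc k Z) :
    phi (x * y) f = phi x (phi y f) := by
  obtain ⟨H, hH⟩ := exists_inv f
  obtain ⟨a, ha⟩ := proj_surj (k := k) H (x.1 H)
  obtain ⟨b, hb⟩ := proj_surj (k := k) H (y.1 H)
  have h : proj k H (a * b) = (x * y).1 H := by
    rw [map_mul, ha, hb]; rfl
  rw [phi_eq y hH hb, phi_eq x (hH.rho b) ha, phi_eq (x * y) hH h, map_mul,
    Module.End.mul_apply]

/-- the action, as an endomorphism -/
noncomputable def phiEnd (x : hatGroupAlgebra k Z) : Module.End k (SmoothCc k Z) where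
  toFun := phi x
  map_add' := phi_add_right x
  map_smul' := phi_smul_right x

/-- the action, linear -/
noncomputable def phiLin (k Z : Type*) [Field k] [CommGroup Z] [TopologicalSpace Z]
    [IsTopologicalGroup Z] [LocallyCompactSpace Z] [T2Space Z]
    [TotallyDisconnectedSpace Z] :
    hatGroupAlgebra k Z →ₗ[k] Module.End k (SmoothCc k Z) where
  toFun := phiEnd
  map_add' x y := LinearMap.ext (phi_add_left x y)
  map_smul' c x := LinearMap.ext (phi_smul_left c x)

/-- the action -/
noncomputable def Phi (k Z : Type*) [Field k] [CommGroup Z] [TopologicalSpace Z]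
    [IsTopologicalGroup Z] [LocallyCompactSpace Z] [T2Space Z]
    [TotallyDisconnectedSpace Z] :
    hatGroupAlgebra k Z →ₐ[k] Module.End k (SmoothCc k Z) :=
  AlgHom.ofLinearMap (phiLin k Z) (LinearMap.ext phi_one)
    (fun x y => LinearMap.ext (phi_mul x y))

lemma Phi_apply (x : hatGroupAlgebra k Z) (f : SmoothCc k Z) : Phi k Z x f = phi x f := rfl

lemma Phi_indH (x : hatGroupAlgebra k Z) (H : CO Z) (y : Z) :
    (Phi k Z x (indH k H)).1 y = (x.1 H).coeff (QuotientGroup.mk y) := by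
  obtain ⟨a, ha⟩ := proj_surj (k := k) H (x.1 H)
  rw [Phi_apply, phi_eq x (inv_indH H) ha, rho_indH, ha]

lemma Phi_injective : Function.Injective (Phi k Z) := by
  intro x y hxy
  apply Subtype.ext
  funext H
  ext q
  obtain ⟨z, rfl⟩ := QuotientGroup.mk_surjective q
  rw [← Phi_indH, ← Phi_indH, hxy]

lemma Phi_commutes (x : hatGroupAlgebra k Z) : CommutesTrans (Phi k Z x) := by
  intro z f h hfh y
  have e : h = tr k Z z f := by ext y; exact hfh y
  obtain ⟨H, hH⟩ := exists_inv f
  obtain ⟨a, ha⟩ := proj_surj (k := k) H (x.1 H)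
  have : Phi k Z x h = tr k Z z (Phi k Z x f) := by
    rw [e, Phi_apply, Phi_apply, phi_eq x hH ha, trans_eq_rho, phi_eq x (hH.rho _) ha,
      trans_eq_rho, rho_comm]
  rw [this]
  rfl

lemma comm_trans {T : Module.End k (SmoothCc k Z)} (hT : CommutesTrans T) (z : Z)
    (f : SmoothCc k Z) : T (tr k Z z f) = tr k Z z (T f) := by
  ext y
  exact hT z f _ (fun _ => rfl) y

lemma comm_rho {T : Module.End k (SmoothCc k Z)} (hT : CommutesTrans T)
    (a : MonoidAlgebra k Z) (f : SmoothCc k Z) : T (rho k Z a f) = rho k Z a (T f) := by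
  induction a using MonoidAlgebra.induction_linear with
  | zero => simp
  | add a b ha hb => simp only [map_add, LinearMap.add_apply, ha, hb]
  | single z c => rw [rho_single, rho_single, map_smul, comm_trans hT]

lemma mem_range {T : Module.End k (SmoothCc k Z)} (hT : CommutesTrans T) :
    ∃ x, Phi k Z x = T := by
  have hinv : ∀ H : CO Z, Inv H (T (indH k H)) := fun H h hh => by
    rw [← comm_trans hT, inv_indH H h hh]
  choose a ha using fun H => exists_rho H (hinv H)
  have key : ∀ (H : CO Z) (f : SmoothCc k Z), Inv H f → T f = rho k Z (a H) f := by
    intro H f hf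
    obtain ⟨b, rfl⟩ := exists_rho H hf
    rw [comm_rho hT, ha, rho_comm]
  refine ⟨⟨fun H => proj k H (a H), ?_⟩, ?_⟩
  · intro i j hij
    rw [map_proj i j hij]
    ext q
    obtain ⟨z, rfl⟩ := QuotientGroup.mk_surjective q
    rw [← rho_indH, ← rho_indH, ← ha j, ← key i _ ((inv_indH j).mono hij)]
  · refine LinearMap.ext fun f => ?_
    obtain ⟨H, hH⟩ := exists_inv f
    rw [Phi_apply, phi_eq _ hH (a := a H) rfl, key H f hH]

end HatAux

/-- Let `Z` be a locally profinite abelian group and `k` a field.  The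
`k`-algebra `E` of `k`-linear endomorphisms of `C_c^∞(Z,k)` commuting with the translation
action of `Z` is isomorphic as a `k`-algebra to `k̂[Z] = lim_{Z'} k[Z/Z']`: there is an
injective `k`-algebra homomorphism `k̂[Z] → End_k(C_c^∞(Z,k))` with image exactly `E`. -/
theorem stmt_16 (k Z : Type*) [Field k] [CommGroup Z] [TopologicalSpace Z]
    [IsTopologicalGroup Z] [LocallyCompactSpace Z] [T2Space Z]
    [TotallyDisconnectedSpace Z] :
    ∃ Φ : hatGroupAlgebra k Z →ₐ[k] Module.End k (SmoothCc k Z),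
      Function.Injective Φ ∧ Set.range Φ = {T | CommutesTrans T} := by
  exact ⟨HatAux.Phi k Z, HatAux.Phi_injective, Set.ext fun T =>
    ⟨fun ⟨x, hx⟩ => hx ▸ HatAux.Phi_commutes x, fun hT => HatAux.mem_range hT⟩⟩
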